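/- Fix k ≥ 2 and a configuration c = {k_1,...,k_l} of positive integers summing to k with size l < k. For each N > k let P_N(c,c) be the probability that the configuration chain stays at c in one step. Then there exists a constant C > 0 (depending on c but not on N) such that 1 − P_N(c,c) = C/N + O(1/N²) as N → ∞. -/

import Mathlib

open Finset

/-- The finite set of triples (father, mother, child) of pairwise distinct individuals. -/
def distinctTriplesFinset (N : ℕ) : Finset (Fin N × Fin N × Fin N) :=
  Finset.univ.filter fun p => p.1 ≠ p.2.1 ∧ p.1 ≠ p.2.2 ∧ p.2.1 ≠ p.2.2

/-- The factor `q_m(x, y, π, μ, κ)`: equals `1_{y_m = x_m}` if `x_m ≠ κ`, and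
`(1/2)·1_{y_m = π} + (1/2)·1_{y_m = μ}` if `x_m = κ`. -/
noncomputable def qFactor {N k : ℕ} (x y : Fin k → Fin N)
    (p : Fin N × Fin N × Fin N) (m : Fin k) : ℝ :=
  if x m = p.2.2 then
    (if y m = p.1 then 1 / 2 else 0) + (if y m = p.2.1 then 1 / 2 else 0)
  else if y m = x m then 1 else 0

/-- The transition matrix `Q` of the annealed `k`-particle Moran chain on `I^k`. -/
noncomputable def Qmat (N k : ℕ) : Matrix (Fin k → Fin N) (Fin k → Fin N) ℝ :=
  fun x y =>
    (1 / ((N : ℝ) * ((N : ℝ) - 1) * ((N : ℝ) - 2))) *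
      ∑ p ∈ distinctTriplesFinset N, ∏ m : Fin k, qFactor x y p m

/-- The configuration `{x}` of `x ∈ I^k`: the multiset of multiplicities with which the
distinct values of `I` appear among the coordinates of `x`. Its size (number of elements,
i.e. number of distinct values) is `(config x).card`. -/
def config {N k : ℕ} (x : Fin k → Fin N) : Multiset ℕ :=
  (Finset.image x Finset.univ).val.map fun v => (Finset.univ.filter fun m => x m = v).card

lemma cx_card {N k : ℕ} (x : Fin k → Fin N) :
    (config x).card = (Finset.image x Finset.univ).card := by
  unfold config
  rw [Multiset.card_map]
  rfl

lemma cx_inj {N k : ℕ} (σ : Equiv.Perm (Fin N)) (x : Fin k → Fin N) :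
    config (fun m => σ (x m)) = config x := by
  unfold config
  have h : Finset.image (fun m => σ (x m)) Finset.univ
      = (Finset.image x Finset.univ).map σ.toEmbedding := by
    ext v; simp [Equiv.eq_symm_apply]
  rw [h, Finset.map_val, Multiset.map_map]
  apply Multiset.map_congr rfl
  intro v _
  simp

lemma q_nonneg {N k : ℕ} (x y : Fin k → Fin N) (p : Fin N × Fin N × Fin N) (m : Fin k) :
    0 ≤ qFactor x y p m := by
  unfold qFactor
  split_ifs <;> norm_num

lemma q_total {N k : ℕ} (x : Fin k → Fin N) (p : Fin N × Fin N × Fin N) :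
    ∑ y : Fin k → Fin N, ∏ m, qFactor x y p m = 1 := by
  have h := Finset.prod_univ_sum (fun _ : Fin k => (Finset.univ : Finset (Fin N)))
    (fun m v => qFactor x (fun _ => v) p m)
  rw [Fintype.piFinset_univ] at h
  have h2 : ∑ y : Fin k → Fin N, ∏ m, qFactor x y p m
      = ∑ y : Fin k → Fin N, ∏ m, qFactor x (fun _ => y m) p m := rfl
  rw [h2, ← h]
  apply Finset.prod_eq_one
  intro m _
  unfold qFactor
  by_cases hm : x m = p.2.2
  · simp only [hm, if_true, Finset.sum_add_distrib]
    simp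
    norm_num
  · simp [hm]

noncomputable def stay {N k : ℕ} (c : Multiset ℕ) (x : Fin k → Fin N)
    (p : Fin N × Fin N × Fin N) : ℝ :=
  ∑ y ∈ Finset.univ.filter (fun y : Fin k → Fin N => config y = c), ∏ m, qFactor x y p m

lemma stay_nonneg {N k : ℕ} (c : Multiset ℕ) (x : Fin k → Fin N)
    (p : Fin N × Fin N × Fin N) : 0 ≤ stay c x p :=
  Finset.sum_nonneg fun y _ => Finset.prod_nonneg fun m _ => q_nonneg x y p m

lemma stay_le {N k : ℕ} (c : Multiset ℕ) (x : Fin k → Fin N)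
    (p : Fin N × Fin N × Fin N) : stay c x p ≤ 1 := by
  rw [← q_total x p]
  exact Finset.sum_le_sum_of_subset_of_nonneg (Finset.filter_subset _ _)
    fun y _ _ => Finset.prod_nonneg fun m _ => q_nonneg x y p m

/-- exit weight of a block of size `a`. -/
noncomputable def wt (a : ℕ) : ℝ := if a = 0 then 0 else 1 - 2 * (1 / 2) ^ a

lemma wt_nonneg (a : ℕ) : 0 ≤ wt a := by
  unfold wt
  split_ifs with h
  · exact le_rfl
  · obtain ⟨b, rfl⟩ := Nat.exists_eq_succ_of_ne_zero h
    have : ((1:ℝ) / 2) ^ b ≤ 1 := pow_le_one₀ (by norm_num) (by norm_num)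
    rw [pow_succ]; linarith

lemma wt_le (a : ℕ) : wt a ≤ 1 := by
  unfold wt
  split_ifs with h
  · norm_num
  · have : 0 ≤ ((1:ℝ) / 2) ^ a := by positivity
    linarith

lemma wt_pos (a : ℕ) (ha : 2 ≤ a) : 0 < wt a := by
  unfold wt
  rw [if_neg (by omega)]
  obtain ⟨b, rfl⟩ := Nat.exists_eq_add_of_le ha
  have : ((1:ℝ) / 2) ^ b ≤ 1 := pow_le_one₀ (by norm_num) (by norm_num)
  rw [pow_add]; linarith

def mult {N k : ℕ} (x : Fin k → Fin N) (v : Fin N) : ℕ :=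
  (Finset.univ.filter fun m => x m = v).card

lemma stay_notin {N k : ℕ} (c : Multiset ℕ) (x : Fin k → Fin N) (hx : config x = c)
    (p : Fin N × Fin N × Fin N) (hp : ∀ m, x m ≠ p.2.2) : 1 - stay c x p - wt (mult x p.2.2) = 0 := by
  have h0 : mult x p.2.2 = 0 := by simp [mult, hp]
  have h1 : stay c x p = 1 := by
    apply le_antisymm (stay_le c x p)
    have : ∏ m, qFactor x x p m = 1 := by
      apply Finset.prod_eq_one
      intro m _
      simp [qFactor, hp]
    rw [← this]
    exact Finset.single_le_sum (f := fun y => ∏ m, qFactor x y p m)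
      (fun y _ => Finset.prod_nonneg fun m _ => q_nonneg x y p m) (by simp [hx])
  simp [h0, h1, wt]

lemma prod_special {N k : ℕ} (x y : Fin k → Fin N) (p : Fin N × Fin N × Fin N) 
    (h : ∀ m, qFactor x y p m = if x m = p.2.2 then 1 / 2 else 1) :
    ∏ m, qFactor x y p m = (1 / 2) ^ mult x p.2.2 := by
  simp_rw [h]
  rw [Finset.prod_ite]
  simp [mult]

lemma stay_in {N k : ℕ} (c : Multiset ℕ) (x : Fin k → Fin N) (hx : config x = c)
    (p : Fin N × Fin N × Fin N) (hd : p ∈ distinctTriplesFinset N)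
    (m0 : Fin k) (hm0 : x m0 = p.2.2) (h1 : ∀ m, x m ≠ p.1) (h2 : ∀ m, x m ≠ p.2.1) :
    1 - stay c x p - wt (mult x p.2.2) = 0 := by
  obtain ⟨a, b, κ⟩ := p
  simp only [distinctTriplesFinset, Finset.mem_filter, Finset.mem_univ, true_and] at hd
  obtain ⟨hab, haκ, hbκ⟩ := hd
  dsimp only at *
  have hmult : mult x κ ≠ 0 := by
    unfold mult
    exact Finset.card_ne_zero_of_mem (a := m0) (by simp [hm0])
  set y1 : Fin k → Fin N := fun m => Equiv.swap κ a (x m) with hy1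
  set y2 : Fin k → Fin N := fun m => Equiv.swap κ b (x m) with hy2
  have e1 : ∀ m, y1 m = if x m = κ then a else x m := by
    intro m; simp only [hy1, Equiv.swap_apply_def, h1 m, if_false]
  have e2 : ∀ m, y2 m = if x m = κ then b else x m := by
    intro m; simp only [hy2, Equiv.swap_apply_def, h2 m, if_false]
  have hne : y1 ≠ y2 := by
    intro h
    have := congrFun h m0
    rw [e1, e2] at this
    simp [hm0] at this
    exact hab this
  have p1 : ∏ m, qFactor x y1 (a, b, κ) m = (1 / 2) ^ mult x κ := by
    apply prod_special x y1 (a, b, κ)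
    intro m
    by_cases hm : x m = κ <;> simp [qFactor, e1, hm, hab]
  have p2 : ∏ m, qFactor x y2 (a, b, κ) m = (1 / 2) ^ mult x κ := by
    apply prod_special x y2 (a, b, κ)
    intro m
    by_cases hm : x m = κ <;> simp [qFactor, e2, hm, hab.symm]
  have hs : stay c x (a, b, κ) = ∑ y ∈ ({y1, y2} : Finset (Fin k → Fin N)),
      ∏ m, qFactor x y (a, b, κ) m := by
    unfold stay
    symm
    apply Finset.sum_subset
    · intro y hy
      simp only [Finset.mem_insert, Finset.mem_singleton] at hy
      rcases hy with rfl | rfl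
      · simp only [Finset.mem_filter, Finset.mem_univ, true_and]
        rw [← hx]; exact cx_inj _ x
      · simp only [Finset.mem_filter, Finset.mem_univ, true_and]
        rw [← hx]; exact cx_inj _ x
    · intro y hy hny
      simp only [Finset.mem_filter, Finset.mem_univ, true_and] at hy
      simp only [Finset.mem_insert, Finset.mem_singleton, not_or] at hny
      by_contra hprod
      have hq : ∀ m, qFactor x y (a, b, κ) m ≠ 0 := fun m =>
        (Finset.prod_ne_zero_iff.mp hprod) m (Finset.mem_univ m)
      have hout : ∀ m, x m ≠ κ → y m = x m := by
        intro m hm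
        by_contra h
        exact hq m (by simp [qFactor, hm, h])
      have hin : ∀ m, x m = κ → y m = a ∨ y m = b := by
        intro m hm
        by_contra! h
        exact hq m (by simp [qFactor, hm, h])
      have hb : ∃ m, y m = b := by
        by_contra! h
        apply hny.1
        funext m
        rw [e1]
        split_ifs with hm
        · exact (hin m hm).resolve_right (h m)
        · exact hout m hm
      have ha : ∃ m, y m = a := by
        by_contra! h
        apply hny.2
        funext m
        rw [e2]
        split_ifs with hm
        · exact (hin m hm).resolve_left (h m)
        · exact hout m hm
      have hsub : insert a (insert b ((Finset.image x Finset.univ).erase κ))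
          ⊆ Finset.image y Finset.univ := by
        intro v hv
        simp only [Finset.mem_insert, Finset.mem_erase, Finset.mem_image, Finset.mem_univ,
          true_and] at hv ⊢
        rcases hv with rfl | rfl | ⟨hv, m, rfl⟩
        · exact ha
        · exact hb
        · exact ⟨m, hout m hv⟩
      have hcard := Finset.card_le_card hsub
      rw [Finset.card_insert_of_notMem (by simp [hab, h1]),
        Finset.card_insert_of_notMem (by simp [h2]),
        Finset.card_erase_of_mem (by simp; exact ⟨m0, hm0⟩), ← cx_card, ← cx_card, hx, hy] at hcard
      omega
  rw [hs, Finset.sum_pair hne, p1, p2, wt, if_neg hmult]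
  ring

lemma sum_triples (N : ℕ) (hN : 3 ≤ N) (F : Fin N → ℝ) :
    ∑ p ∈ distinctTriplesFinset N, F p.2.2 = ((N:ℝ) - 1) * ((N:ℝ) - 2) * ∑ v, F v := by
  rw [← Finset.sum_fiberwise (s := distinctTriplesFinset N) (g := fun p => p.2.2),
    Finset.mul_sum]
  apply Finset.sum_congr rfl
  intro v _
  rw [Finset.sum_congr rfl (g := fun _ => F v)]
  · rw [Finset.sum_const, nsmul_eq_mul]
    congr 1
    have : ((distinctTriplesFinset N).filter fun p => p.2.2 = v)
        = ((Finset.univ.erase v).offDiag).map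
          ⟨fun q => (q.1, q.2, v), by
            rintro ⟨a, b⟩ ⟨a', b'⟩ h
            simpa using h⟩ := by
      ext ⟨a, b, κ⟩
      simp only [distinctTriplesFinset, Finset.mem_filter, Finset.mem_univ, true_and,
        Finset.mem_map, Finset.mem_offDiag, Finset.mem_erase, Function.Embedding.coeFn_mk,
        Prod.exists, Prod.mk.injEq, and_true]
      constructor
      · rintro ⟨⟨h1, h2, h3⟩, rfl⟩
        exact ⟨a, b, ⟨h2, h3, h1⟩, rfl⟩
      · rintro ⟨a', b', ⟨h2, h3, h1⟩, heq⟩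
        cases heq
        exact ⟨⟨h1, h2, h3⟩, rfl⟩
    rw [this, Finset.card_map, Finset.offDiag_card, Finset.card_erase_of_mem (Finset.mem_univ _),
      Finset.card_univ, Fintype.card_fin]
    obtain ⟨n, rfl⟩ := Nat.exists_eq_add_of_le hN
    have : (3 + n - 1) * (3 + n - 1) - (3 + n - 1) = (n + 2) * (n + 1) := by
      have : 3 + n - 1 = n + 2 := by omega
      rw [this]
      apply Nat.sub_eq_of_eq_add
      ring
    rw [this]
    push_cast
    ring
  · intro p hp
    rw [(Finset.mem_filter.mp hp).2]

lemma sum_wt {N k : ℕ} (x : Fin k → Fin N) :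
    ∑ v, wt (mult x v) = ((config x).map wt).sum := by
  unfold config
  rw [Multiset.map_map]
  change _ = ∑ v ∈ Finset.image x Finset.univ, wt (mult x v)
  symm
  apply Finset.sum_subset (Finset.subset_univ _)
  intro v _ hv
  have : mult x v = 0 := by
    simp only [Finset.mem_image, Finset.mem_univ, true_and, not_exists] at hv
    simp [mult, hv]
  simp [this, wt]

lemma C_pos (k : ℕ) (c : Multiset ℕ) (hcsum : c.sum = k) (hccard : c.card < k) :
    0 < (c.map wt).sum := by
  have : ∃ a ∈ c, 2 ≤ a := by
    by_contra! h
    have := Multiset.sum_le_card_nsmul c 1 (fun a ha => by have := h a ha; omega)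
    simp at this
    omega
  obtain ⟨a, ha, h2⟩ := this
  obtain ⟨d, rfl⟩ := Multiset.exists_cons_of_mem ha
  rw [Multiset.map_cons, Multiset.sum_cons]
  have h3 : 0 ≤ (d.map wt).sum := Multiset.sum_nonneg (by
    intro r hr
    obtain ⟨b, _, rfl⟩ := Multiset.mem_map.mp hr
    exact wt_nonneg b)
  have := wt_pos a h2
  linarith

lemma err_bound {N k : ℕ} (c : Multiset ℕ) (x : Fin k → Fin N) (hx : config x = c) :
    |∑ p ∈ distinctTriplesFinset N, (1 - stay c x p - wt (mult x p.2.2))| ≤ 2 * (k:ℝ) ^ 2 * N := by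
  classical
  set im := Finset.image x Finset.univ with him
  have hmem : ∀ v, v ∉ im → ∀ m, x m ≠ v := by
    intro v hv m h
    exact hv (by simp only [him, Finset.mem_image]; exact ⟨m, Finset.mem_univ _, h⟩)
  set B : Finset (Fin N × Fin N × Fin N) :=
    (im ×ˢ (Finset.univ ×ˢ im)) ∪ (Finset.univ ×ˢ (im ×ˢ im)) with hB
  have hle : im.card ≤ k := by
    simpa using (Finset.card_image_le (s := (Finset.univ : Finset (Fin k))) (f := x))
  have hcard : B.card ≤ 2 * k ^ 2 * N := by
    refine (Finset.card_union_le _ _).trans ?_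
    simp only [Finset.card_product, Finset.card_univ, Fintype.card_fin]
    have : im.card * im.card ≤ k * k := Nat.mul_le_mul hle hle
    nlinarith [Nat.mul_le_mul_right N this]
  refine (Finset.abs_sum_le_sum_abs _ _).trans ?_
  have step : ∑ p ∈ distinctTriplesFinset N, |1 - stay c x p - wt (mult x p.2.2)|
      ≤ ∑ p ∈ distinctTriplesFinset N, if p ∈ B then (1:ℝ) else 0 := by
    apply Finset.sum_le_sum
    intro p hp
    split_ifs with hpB
    · rw [abs_le]
      have := stay_nonneg c x p
      have := stay_le c x p
      have := wt_nonneg (mult x p.2.2)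
      have := wt_le (mult x p.2.2)
      constructor <;> linarith
    · by_cases h3 : p.2.2 ∈ im
      · have h1 : p.1 ∉ im := fun h => hpB (by simp [hB, h, h3])
        have h2 : p.2.1 ∉ im := fun h => hpB (by simp [hB, h, h3])
        obtain ⟨m0, _, hm0⟩ := Finset.mem_image.mp h3
        rw [stay_in c x hx p hp m0 hm0 (hmem _ h1) (hmem _ h2)]
        simp
      · rw [stay_notin c x hx p (hmem _ h3)]
        simp
  refine step.trans ?_
  rw [Finset.sum_ite_mem]
  simp only [Finset.sum_const, nsmul_eq_mul, mul_one]
  have : (distinctTriplesFinset N ∩ B).card ≤ 2 * k ^ 2 * N :=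
    (Finset.card_le_card Finset.inter_subset_right).trans hcard
  exact_mod_cast this

/-- For a configuration `c = {k_1, ..., k_l}` of positive integers summing to `k` with size
`l < k`, the probability of leaving `c` in one step satisfies
`1 - P_N(c, c) = C/N + O(1/N²)` for some constant `C > 0` not depending on `N`. -/
theorem configChain_exit_rate
    (k : ℕ) (hk : 2 ≤ k)
    (c : Multiset ℕ) (hc : ∀ a ∈ c, 0 < a) (hcsum : c.sum = k) (hccard : c.card < k) :
    ∃ C : ℝ, 0 < C ∧ ∃ D : ℝ, ∀ N : ℕ, k < N → ∀ x : Fin k → Fin N, config x = c →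
      |(1 - ∑ y ∈ Finset.univ.filter (fun y : Fin k → Fin N => config y = c), Qmat N k x y)
        - C / (N : ℝ)| ≤ D / (N : ℝ) ^ 2 := by
  refine ⟨(c.map wt).sum, C_pos k c hcsum hccard, 9 * (k:ℝ) ^ 2, ?_⟩
  intro N hN x hx
  have hN3 : 3 ≤ N := by omega
  have hNr : (3:ℝ) ≤ N := by exact_mod_cast hN3
  have hE := err_bound c x hx
  have hT := sum_triples N hN3 (fun v => wt (mult x v))
  have hO := sum_triples N hN3 (fun _ => (1:ℝ))
  simp only [Finset.sum_const, Finset.card_univ, Fintype.card_fin, nsmul_eq_mul, mul_one] at hO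
  rw [sum_wt, hx] at hT
  have hQ : ∑ y ∈ Finset.univ.filter (fun y : Fin k → Fin N => config y = c), Qmat N k x y
      = (1 / ((N : ℝ) * ((N : ℝ) - 1) * ((N : ℝ) - 2))) *
        ∑ p ∈ distinctTriplesFinset N, stay c x p := by
    unfold Qmat stay
    rw [← Finset.mul_sum, Finset.sum_comm]
  rw [Finset.sum_sub_distrib, Finset.sum_sub_distrib, hT] at hE
  simp only [Finset.sum_const, nsmul_eq_mul, mul_one] at hE
  rw [hO] at hE
  rw [hQ]
  set S := ∑ p ∈ distinctTriplesFinset N, stay c x p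
  set C := (c.map wt).sum
  have n0 : (N:ℝ) ≠ 0 := by linarith
  have n1 : (N:ℝ) - 1 ≠ 0 := by linarith
  have n2 : (N:ℝ) - 2 ≠ 0 := by linarith
  have pos : 0 < (N : ℝ) * ((N : ℝ) - 1) * ((N : ℝ) - 2) :=
    mul_pos (mul_pos (by linarith) (by linarith)) (by linarith)
  have key : 1 - 1 / ((N : ℝ) * ((N : ℝ) - 1) * ((N : ℝ) - 2)) * S - C / N
      = (((N : ℝ) - 1) * ((N : ℝ) - 2) * N - S - ((N : ℝ) - 1) * ((N : ℝ) - 2) * C)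
        / ((N : ℝ) * ((N : ℝ) - 1) * ((N : ℝ) - 2)) := by
    field_simp
  rw [key, abs_div, abs_of_pos pos]
  refine (div_le_div_of_nonneg_right hE pos.le).trans ?_
  rw [div_le_div_iff₀ pos (by positivity)]
  have hpoly : 2 * (N:ℝ) ^ 2 ≤ 9 * (((N : ℝ) - 1) * ((N : ℝ) - 2)) := by nlinarith
  have := mul_le_mul_of_nonneg_left hpoly (show 0 ≤ (k:ℝ) ^ 2 * N by positivity)
  nlinarith
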